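/- arXiv:2204.05069 — 3 statements merged into one kernel-verified Lean document; each statement's English description precedes it below -/
import Mathlib

section
/- Let K be a field of characteristic zero, a0 ∈ K* a nonzero constant, and a1(x), a2(x) ∈ K[x] with deg a1(x) ≥ 1 and deg a2(x) ≥ 1. Suppose there exists no l ∈ K* such that a2(x) = l·a1(x) − l²·a0. Then the K-derivation D = y∂x + (a2(x)y² + a1(x)y + a0)∂y of K[x,y] has no Darboux polynomial; that is, there exist no F ∈ K[x,y] with F ∉ K and no Λ ∈ K[x,y] such that D(F) = Λ·F. -/
open Polynomial
theorem withBotNat_eq_bot_or_natCast (x : WithBot ℕ) : x = ⊥ ∨ ∃ m : ℕ, x = m := by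
  cases x with
  | bot => exact Or.inl rfl
  | coe m => exact Or.inr ⟨m, rfl⟩

theorem natCast_sub_natCast_add_one_ne_zero {K : Type*} [Field K] [CharZero K] {n k : ℕ}
    (h : k ≤ n) : (n : K) - k + 1 ≠ 0 := by
  rw [← Nat.cast_sub h]
  exact_mod_cast (n - k).succ_ne_zero

theorem degree_C_mul_mul_sub_derivative {K : Type*} [Field K] {c : K} (hc : c ≠ 0) {a : K[X]}
    (ha : 1 ≤ a.degree) (p : K[X]) :
    (C c * a * p - derivative p).degree = a.degree + p.degree := by
  rcases eq_or_ne p 0 with rfl | hp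
  · simp
  have key : (C c * a * p).degree = a.degree + p.degree := by
    rw [mul_assoc, degree_C_mul hc, degree_mul]
  rw [← key]
  apply degree_sub_eq_left_of_degree_lt
  rw [key]
  calc (derivative p).degree < p.degree := degree_derivative_lt hp
    _ ≤ a.degree + p.degree := le_add_of_nonneg_left (zero_le_one.trans ha)

theorem eq_zero_of_C_mul_mul_sub_derivative_eq_C {K : Type*} [Field K] {c b : K} (hc : c ≠ 0)
    {a p : K[X]} (ha : 1 ≤ a.degree) (h : C c * a * p - derivative p = C b) : b = 0 := by
  have hdeg := degree_C_mul_mul_sub_derivative hc ha p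
  rcases eq_or_ne p 0 with rfl | hp
  · simpa using h.symm
  · rw [h] at hdeg
    have h1 : (1 : WithBot ℕ) ≤ 0 := by
      calc (1 : WithBot ℕ) ≤ a.degree := ha
        _ ≤ a.degree + p.degree := le_add_of_nonneg_right (zero_le_degree_iff.mpr hp)
        _ ≤ 0 := hdeg ▸ degree_C_le
    exact absurd h1 (by decide)

/-- The relations between the `y`-coefficients `f k` of a Darboux polynomial of
`y ∂x + (a2 y² + a1 y + a0) ∂y` that is monic of degree `n` in `y` and has cofactor `n a2 y + s`;
the sequence `h` is `f` shifted by one. -/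
structure IsDarbouxRecurrence {K : Type*} [Field K] (a0 : K) (a1 a2 s : K[X]) (n : ℕ)
    (f h : ℕ → K[X]) : Prop where
  h_zero : h 0 = 0
  h_succ : ∀ k, h (k + 1) = f k
  top : f n = 1
  above : f (n + 1) = 0
  eqn : ∀ k : ℕ, C ((n : K) - k + 1) * a2 * h k - derivative (h k) =
    (C (k : K) * a1 - s) * f k + C (((k : K) + 1) * a0) * f (k + 1)

namespace IsDarbouxRecurrence
variable {K : Type*} [Field K] {a0 : K} {a1 a2 s : K[X]} {n : ℕ} {f h : ℕ → K[X]}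

theorem f_zero_ne [CharZero K] (H : IsDarbouxRecurrence a0 a1 a2 s n f h) (ha0 : a0 ≠ 0) :
    f 0 ≠ 0 := by
  intro h0
  have : ∀ k, f k = 0 ∧ h k = 0 := by
    intro k
    induction k with
    | zero => exact ⟨h0, H.h_zero⟩
    | succ k ih =>
      refine ⟨?_, by rw [H.h_succ, ih.1]⟩
      have := H.eqn k
      rw [ih.1, ih.2] at this
      have hk : (k : K) + 1 ≠ 0 := by exact_mod_cast k.succ_ne_zero
      simp only [mul_zero, map_zero, sub_zero, zero_add] at this
      exact (mul_eq_zero.mp this.symm).resolve_left (C_ne_zero.mpr (mul_ne_zero hk ha0))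
  have h1 := H.top
  rw [(this n).1] at h1
  exact zero_ne_one h1

theorem degree_ascent [CharZero K] (H : IsDarbouxRecurrence a0 a1 a2 s n f h) (ha0 : a0 ≠ 0)
    (ha2 : 1 ≤ a2.degree)
    {d M : ℕ} (hd : a2.degree = d) (hdM : d ≤ M) (hM : 1 ≤ M) {N : ℕ} (hNn : N ≤ n)
    (hN : ∀ k < N, (C (k : K) * a1 - s).degree = M) :
    ∀ k ≤ N, (f k).degree = ((f 0).natDegree + k * M : ℕ) ∧
      (h k).degree + M ≤ ((f 0).natDegree + k * M : ℕ) := by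
  intro k
  induction k with
  | zero =>
    intro _
    simp [H.h_zero, degree_eq_natDegree (H.f_zero_ne ha0)]
  | succ k ih =>
    intro hk
    obtain ⟨ih1, ih2⟩ := ih (by omega)
    have hlast : (f k).degree + M = ((f 0).natDegree + (k + 1) * M : ℕ) := by
      rw [ih1]; norm_cast; ring
    rw [H.h_succ]
    refine ⟨?_, hlast.le⟩
    have hk1 : (k : K) + 1 ≠ 0 := by exact_mod_cast k.succ_ne_zero
    have hc : (n : K) - k + 1 ≠ 0 := natCast_sub_natCast_add_one_ne_zero (by omega)
    have e : f (k + 1) = C ((((k : K) + 1) * a0)⁻¹) *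
        (C ((n : K) - k + 1) * a2 * h k - derivative (h k) - (C (k : K) * a1 - s) * f k) := by
      rw [H.eqn k, add_sub_cancel_left, ← mul_assoc, ← C_mul, inv_mul_cancel₀ (mul_ne_zero hk1 ha0)]
      simp
    have d2 : ((C (k : K) * a1 - s) * f k).degree = ((f 0).natDegree + (k + 1) * M : ℕ) := by
      rw [degree_mul, hN k (by omega), add_comm, hlast]
    rw [e, degree_C_mul (inv_ne_zero (mul_ne_zero hk1 ha0)), degree_sub_eq_right_of_degree_lt, d2]
    rw [d2, degree_C_mul_mul_sub_derivative hc ha2, hd]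
    obtain hx | ⟨x, hx⟩ := withBotNat_eq_bot_or_natCast (h k).degree
    · rw [hx, WithBot.add_bot]
      exact WithBot.bot_lt_coe _
    · rw [hx] at ih2 ⊢
      norm_cast at ih2 ⊢
      rw [Nat.add_mul]
      omega

theorem degree_descent [CharZero K] (H : IsDarbouxRecurrence a0 a1 a2 s n f h)
    (ha2 : 1 ≤ a2.degree)
    {d m k0 : ℕ} (hd : a2.degree = d)
    (hN : ∀ k, k0 < k → (C (k : K) * a1 - s).degree = (d + m : ℕ)) :
    ∀ j k, k + j = n → k0 ≤ k → (f k).degree = (j * m : ℕ) ∧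
      (f (k + 1)).degree + m ≤ (j * m : ℕ) := by
  intro j
  induction j with
  | zero =>
    rintro k rfl _
    have h1 := H.top
    have h2 := H.above
    simp_all
  | succ j ih =>
    intro k hk hk0
    obtain ⟨ih1, ih2⟩ := ih (k + 1) (by omega) (by omega)
    have hlast : (f (k + 1)).degree + m = ((j + 1) * m : ℕ) := by
      rw [ih1]; norm_cast; ring
    refine ⟨?_, hlast.le⟩
    have hc : (n : K) - (k + 1 : ℕ) + 1 ≠ 0 := natCast_sub_natCast_add_one_ne_zero (by omega)
    have e := congrArg degree (H.eqn (k + 1))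
    have hd1 : 1 ≤ d := by rw [hd] at ha2; exact_mod_cast ha2
    rw [degree_C_mul_mul_sub_derivative hc ha2, degree_add_eq_left_of_degree_lt, degree_mul,
      hN _ (by omega), hd, H.h_succ, ih1] at e
    · obtain hx | ⟨x, hx⟩ := withBotNat_eq_bot_or_natCast (f k).degree
      · rw [hx, WithBot.add_bot] at e
        rw [← Nat.cast_add] at e
        exact absurd e.symm (WithBot.natCast_ne_bot _)
      · rw [hx] at e ⊢
        norm_cast at e ⊢
        rw [Nat.add_mul]
        omega
    · rw [degree_mul (q := f (k + 1)), hN _ (by omega), ih1, ← smul_eq_C_mul]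
      refine (degree_smul_le _ _).trans_lt ?_
      obtain hx | ⟨x, hx⟩ := withBotNat_eq_bot_or_natCast (f (k + 1 + 1)).degree
      · rw [hx]
        exact WithBot.bot_lt_coe _
      · rw [hx] at ih2 ⊢
        norm_cast at ih2 ⊢
        omega

theorem eqn_top (H : IsDarbouxRecurrence a0 a1 a2 s (n + 1) f h) :
    C 1 * a2 * f n - derivative (f n) = C ((n + 1 : ℕ) : K) * a1 - s := by
  simpa [H.top, H.above, H.h_succ] using H.eqn (n + 1)

theorem eqn_subtop (H : IsDarbouxRecurrence a0 a1 a2 s (n + 1) f h) :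
    C 2 * a2 * h n - derivative (h n) =
      (C (n : K) * a1 - s) * f n + C (((n + 1 : ℕ) : K) * a0) := by
  have e := H.eqn n
  have e2 : ((n + 1 : ℕ) : K) - n + 1 = 2 := by push_cast; ring
  rw [e2, H.top, mul_one] at e
  simpa using e

theorem elim [CharZero K] (H : IsDarbouxRecurrence a0 a1 a2 s (n + 1) f h) (ha0 : a0 ≠ 0)
    (ha1 : 1 ≤ a1.degree) (ha2 : 1 ≤ a2.degree)
    (hl : ¬ ∃ l : K, l ≠ 0 ∧ a2 = C l * a1 - C (l ^ 2 * a0)) : False := by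
  have hn0 : ((n + 1 : ℕ) : K) ≠ 0 := by exact_mod_cast n.succ_ne_zero
  have hg : f n ≠ 0 := by
    intro hg
    have e := H.eqn_subtop
    rw [hg, mul_zero, zero_add] at e
    exact mul_ne_zero hn0 ha0 (eq_zero_of_C_mul_mul_sub_derivative_eq_C two_ne_zero ha2 e)
  have hd : a2.degree = a2.natDegree :=
    degree_eq_natDegree (by rintro rfl; simp at ha2)
  have hd1 : 1 ≤ a2.natDegree := by rw [hd] at ha2; exact_mod_cast ha2
  have ha1n : 1 ≤ a1.natDegree := by
    rw [degree_eq_natDegree (by rintro rfl; simp at ha1)] at ha1; exact_mod_cast ha1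
  generalize a2.natDegree = d at hd hd1
  obtain ⟨M, hMdef⟩ : ∃ M, M = max s.natDegree a1.natDegree := ⟨_, rfl⟩
  have hsM : s.natDegree ≤ M := by omega
  have haM : a1.natDegree ≤ M := by omega
  have hM1 : 1 ≤ M := by omega
  have hcoeff : a1.coeff M ≠ 0 ∨ s.coeff M ≠ 0 := by
    rcases max_choice s.natDegree a1.natDegree with hm | hm
    · right
      rw [hMdef, hm, coeff_natDegree, leadingCoeff_ne_zero]
      rintro rfl
      simp at hm
      omega
    · left
      rw [hMdef, hm, coeff_natDegree, leadingCoeff_ne_zero]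
      rintro rfl
      simp at ha1n
  have hle (k : ℕ) : (C (k : K) * a1 - s).degree ≤ M :=
    degree_le_of_natDegree_le
      ((natDegree_sub_le _ _).trans (max_le ((natDegree_C_mul_le _ _).trans haM) hsM))
  have heq (k : ℕ) (hk : (k : K) * a1.coeff M ≠ s.coeff M) :
      (C (k : K) * a1 - s).degree = M :=
    degree_eq_of_le_of_coeff_ne_zero (hle k) (by simpa [sub_eq_zero] using hk)
  have hdg : (d : WithBot ℕ) + (f n).degree ≤ M := by
    rw [← hd, ← degree_C_mul_mul_sub_derivative one_ne_zero ha2, H.eqn_top]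
    exact hle _
  have hdM : d ≤ M := by
    rw [degree_eq_natDegree hg] at hdg
    norm_cast at hdg
    omega
  obtain ⟨k0, hk0n, hk0⟩ : ∃ k0 < n + 1, (k0 : K) * a1.coeff M = s.coeff M := by
    by_contra! hcon
    have := (H.degree_ascent ha0 ha2 hd hdM hM1 le_rfl (fun k hk => heq k (hcon k hk))
      (n + 1) le_rfl).1
    rw [H.top, degree_one] at this
    norm_cast at this
    have : 0 < (n + 1) * M := Nat.mul_pos n.succ_pos hM1
    omega
  have hα : a1.coeff M ≠ 0 := by
    intro h0
    rw [h0, mul_zero] at hk0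
    exact hcoeff.elim (fun h => h h0) (fun h => h hk0.symm)
  have hne (k : ℕ) (hk : k ≠ k0) : (C (k : K) * a1 - s).degree = M := by
    refine heq k fun h => hk ?_
    rw [← hk0] at h
    exact_mod_cast mul_right_cancel₀ hα h
  obtain ⟨m, rfl⟩ := Nat.exists_eq_add_of_le hdM
  obtain ⟨p, hp⟩ := Nat.exists_eq_add_of_lt hk0n
  have hdesc := H.degree_descent ha2 hd fun k (hk : k0 < k) => hne k hk.ne'
  have hasc := H.degree_ascent ha0 ha2 hd hdM hM1 hk0n.le (fun k hk => hne k hk.ne) k0 le_rfl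
  obtain ⟨hfk, hfk1⟩ := hdesc (p + 1) k0 (by omega) le_rfl
  have hgm := (hdesc 1 n rfl (by omega)).1
  -- The exceptional coefficient is a constant
  have hconst : (C (k0 : K) * a1 - s).degree + m ≤ 0 := by
    have hc : ((n + 1 : ℕ) : K) - k0 + 1 ≠ 0 := natCast_sub_natCast_add_one_ne_zero hk0n.le
    have e : (C (k0 : K) * a1 - s) * f k0 =
        (C (((n + 1 : ℕ) : K) - k0 + 1) * a2 * h k0 - derivative (h k0)) -
          C (((k0 : K) + 1) * a0) * f (k0 + 1) := by
      rw [H.eqn k0]; ring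
    have hub : ((C (k0 : K) * a1 - s) * f k0).degree + m ≤ ((p + 1) * m : ℕ) := by
      rw [e]
      rcases le_max_iff.mp (degree_sub_le (C (((n + 1 : ℕ) : K) - k0 + 1) * a2 * h k0 -
        derivative (h k0)) (C (((k0 : K) + 1) * a0) * f (k0 + 1))) with hle | hle
      · refine (add_le_add_left hle _).trans ?_
        rw [degree_C_mul_mul_sub_derivative hc ha2, hd, ← hfk, hasc.1]
        refine le_trans (le_of_eq ?_) hasc.2
        push_cast
        ring
      · refine (add_le_add_left (hle.trans ?_) _).trans hfk1
        rw [← smul_eq_C_mul]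
        exact degree_smul_le _ _
    rw [degree_mul, hfk] at hub
    obtain hx | ⟨x, hx⟩ := withBotNat_eq_bot_or_natCast (C (k0 : K) * a1 - s).degree
    · rw [hx, WithBot.bot_add]
      exact bot_le
    · rw [hx] at hub ⊢
      norm_cast at hub ⊢
      omega
  obtain ⟨c, hc⟩ : ∃ c, C (k0 : K) * a1 - s = C c :=
    ⟨_, eq_C_of_degree_le_zero ((le_add_of_nonneg_right (Nat.cast_nonneg' m)).trans hconst)⟩
  have hcm : c = 0 ∨ m = 0 := by
    rw [hc] at hconst
    by_contra! hcon
    rw [degree_C hcon.1, zero_add] at hconst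
    exact hcon.2 (by exact_mod_cast nonpos_iff_eq_zero.mp (by exact_mod_cast hconst))
  have hs : s = C (k0 : K) * a1 - C c := by rw [← hc]; ring
  have hpK : ((n + 1 : ℕ) : K) = k0 + p + 1 := by exact_mod_cast congrArg (Nat.cast (R := K)) hp
  have e1 := H.eqn_top
  have e2 := H.eqn_subtop
  have hnK : (n : K) = k0 + p := by
    have := hpK
    push_cast at this
    linear_combination this
  rw [hs, hpK] at e1
  rw [hs, hnK] at e2
  have key : C 2 * a2 * (C (2 * ((p : K) + 1)) * h n - C (p : K) * f n ^ 2) -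
      derivative (C (2 * ((p : K) + 1)) * h n - C (p : K) * f n ^ 2) =
      C 2 * (C c * f n + C ((p + 1) * (((n + 1 : ℕ) : K) * a0))) := by
    have h2 : (C 2 : K[X]) = 2 := rfl
    simp only [pow_two, derivative_sub, derivative_mul, derivative_C]
    simp only [C_mul, C_add, C_1, h2] at e1 e2 ⊢
    linear_combination 2 * (C (p : K) + 1) * e2 - 2 * C (p : K) * f n * e1
  rcases hcm with rfl | rfl
  · rw [C_0, zero_mul, zero_add, ← C_mul] at key
    have := eq_zero_of_C_mul_mul_sub_derivative_eq_C two_ne_zero ha2 key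
    have hp0 : (p : K) + 1 ≠ 0 := by exact_mod_cast p.succ_ne_zero
    simp_all
  · obtain ⟨γ, hγ⟩ : ∃ γ, f n = C γ := ⟨_, eq_C_of_degree_le_zero (by simp [hgm])⟩
    have hγ0 : γ ≠ 0 := by rintro rfl; simp [hγ] at hg
    have hk00 : k0 = 0 := by
      have := hasc.1
      rw [hfk] at this
      norm_cast at this
      by_contra hcon
      have := Nat.mul_pos (Nat.pos_of_ne_zero hcon) hM1
      omega
    subst hk00
    rw [hγ, ← C_mul, ← C_add, ← C_mul] at key
    have hz := eq_zero_of_C_mul_mul_sub_derivative_eq_C two_ne_zero ha2 key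
    have hz' : c * γ = -((p + 1) ^ 2 * a0) := by
      rw [hpK] at hz
      have := (mul_eq_zero.mp hz).resolve_left two_ne_zero
      push_cast at this
      linear_combination this
    have hp0 : (p : K) + 1 ≠ 0 := by exact_mod_cast p.succ_ne_zero
    refine hl ⟨(p + 1) / γ, div_ne_zero hp0 hγ0, ?_⟩
    have hc' : ((p + 1) / γ) ^ 2 * a0 = -(c / γ) := by
      field_simp
      linear_combination hz'
    have hγγ : (C γ⁻¹ : K[X]) * C γ = 1 := by rw [← C_mul, inv_mul_cancel₀ hγ0, C_1]
    rw [hc', div_eq_mul_inv, div_eq_mul_inv]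
    rw [hγ] at e1
    simp at e1 ⊢
    linear_combination C γ⁻¹ * e1 - a2 * hγγ

end IsDarbouxRecurrence

/-- The derivation `∂/∂x` of `K[x][y]`. -/
noncomputable def coeffwiseDerivative (K : Type*) [Field K] : Derivation K K[X][X] K[X][X] :=
  (PolynomialModule.equivPolynomialSelf (R := K[X])).toLinearMap.compDer
    (derivative' (R := K)).mapCoeffs

theorem coeff_coeffwiseDerivative {K : Type*} [Field K] (P : K[X][X]) (k : ℕ) :
    (coeffwiseDerivative K P).coeff k = derivative (P.coeff k) := rfl

/-- The derivation `y ∂/∂x + q ∂/∂y` of `K[x][y]`. -/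
noncomputable def vectorFieldDerivation {K : Type*} [Field K] (q : K[X][X]) :
    Derivation K K[X][X] K[X][X] :=
  (X : K[X][X]) • coeffwiseDerivative K + q • (derivative' (R := K[X])).restrictScalars K

theorem vectorFieldDerivation_apply {K : Type*} [Field K] (q P : K[X][X]) :
    vectorFieldDerivation q P = X * coeffwiseDerivative K P + q * derivative P := by
  rfl

theorem coeffwiseDerivative_C {K : Type*} [Field K] (a : K[X]) :
    coeffwiseDerivative K (C a) = C (derivative a) := by
  ext1 k
  rw [coeff_coeffwiseDerivative, coeff_C, coeff_C]
  split_ifs <;> simp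

theorem coeffwiseDerivative_X {K : Type*} [Field K] :
    coeffwiseDerivative K X = 0 := by
  ext1 k
  rw [coeff_coeffwiseDerivative, coeff_X]
  split_ifs <;> simp

/-- The identification of `K[x, y]` with `K[x][y]`. -/
noncomputable def toBivariate (K : Type*) [Field K] : MvPolynomial (Fin 2) K →ₐ[K] K[X][X] :=
  MvPolynomial.aeval ![C X, X]

theorem toBivariate_eq_C_C {K : Type*} [Field K] {F : MvPolynomial (Fin 2) K} {k : K}
    (h : toBivariate K F = C (C k)) : F = MvPolynomial.C k := by
  let ψ : K[X][X] →+* MvPolynomial (Fin 2) K :=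
    eval₂RingHom (aeval (MvPolynomial.X 0)).toRingHom (MvPolynomial.X 1)
  have hψ (G : MvPolynomial (Fin 2) K) : ψ (toBivariate K G) = G := by
    induction G using MvPolynomial.induction_on with
    | C a => simp [toBivariate, ψ, MvPolynomial.algebraMap_eq, Polynomial.algebraMap_eq]
    | add p q hp hq => rw [map_add, map_add, hp, hq]
    | mul_X p i hp =>
      rw [map_mul, map_mul, hp]
      fin_cases i <;> simp [toBivariate, ψ]
  rw [← hψ F, h]
  simp [ψ, MvPolynomial.algebraMap_eq]

theorem toBivariate_derivation {K : Type*} [Field K]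
    (D : Derivation K (MvPolynomial (Fin 2) K) (MvPolynomial (Fin 2) K))
    (q : K[X][X])
    (hDx : D (MvPolynomial.X 0) = MvPolynomial.X 1)
    (hDy : toBivariate K (D (MvPolynomial.X 1)) = q) (F : MvPolynomial (Fin 2) K) :
    toBivariate K (D F) = vectorFieldDerivation q (toBivariate K F) := by
  induction F using MvPolynomial.induction_on with
  | C a =>
    rw [← MvPolynomial.algebraMap_eq, Derivation.map_algebraMap, map_zero, AlgHom.commutes,
      Derivation.map_algebraMap]
  | add p q hp hq => simp only [map_add, hp, hq]
  | mul_X p i hp =>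
    have hX : toBivariate K (D (MvPolynomial.X i)) =
        vectorFieldDerivation q (toBivariate K (MvPolynomial.X i)) := by
      fin_cases i
      · simp [hDx, toBivariate, vectorFieldDerivation_apply, coeffwiseDerivative_C]
      · simp only [Fin.mk_one, hDy]
        simp [toBivariate, vectorFieldDerivation_apply, coeffwiseDerivative_X]
    rw [Derivation.leibniz, map_mul, Derivation.leibniz]
    simp [hp, hX]

theorem eq_C_C_of_darboux {K : Type*} [Field K] [CharZero K] {a0 : K} (ha0 : a0 ≠ 0)
    {a1 a2 : K[X]} (ha1 : 1 ≤ a1.degree) (ha2 : 1 ≤ a2.degree)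
    (hl : ¬ ∃ l : K, l ≠ 0 ∧ a2 = C l * a1 - C (l ^ 2 * a0)) {P L : K[X][X]}
    (h : vectorFieldDerivation (C a2 * X ^ 2 + C a1 * X + C (C a0)) P = L * P) :
    ∃ k : K, P = C (C k) := by
  rcases eq_or_ne P 0 with rfl | hP
  · exact ⟨0, by simp⟩
  obtain ⟨n, hn⟩ : ∃ n, P.natDegree = n := ⟨_, rfl⟩
  rw [vectorFieldDerivation_apply] at h
  have hL : L.natDegree ≤ 1 := by
    have h1 : (L * P).natDegree ≤ n + 1 := by
      rw [← h]
      refine (natDegree_add_le _ _).trans (max_le ?_ ?_)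
      · refine natDegree_mul_le.trans ?_
        rw [natDegree_X, add_comm]
        gcongr
        refine natDegree_le_iff_coeff_eq_zero.mpr fun N hN => ?_
        rw [coeff_coeffwiseDerivative, coeff_eq_zero_of_natDegree_lt (by omega), derivative_zero]
      · rcases Nat.eq_zero_or_pos n with h0 | h0
        · rw [natDegree_eq_zero.mp (hn.trans h0) |>.choose_spec.symm]
          simp
        · refine natDegree_mul_le.trans ?_
          have := natDegree_quadratic_le (a := a2) (b := a1) (c := C a0)
          have := natDegree_derivative_le P
          omega
    rcases eq_or_ne L 0 with rfl | hL0
    · simp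
    · rw [natDegree_mul hL0 hP] at h1
      omega
  obtain ⟨s, t, rfl⟩ : ∃ s t : K[X], L = C t * X + C s :=
    ⟨_, _, eq_X_add_C_of_natDegree_le_one hL⟩
  have hc (k : ℕ) : derivative ((X * P).coeff k) + a2 * (((k : K[X]) - 1) * (X * P).coeff k) +
      a1 * ((k : K[X]) * P.coeff k) + C a0 * (((k : K[X]) + 1) * P.coeff (k + 1)) =
      t * (X * P).coeff k + s * P.coeff k := by
    have h' := congrArg (fun Q : K[X][X] => Q.coeff k) h
    have e1 : (C a2 * X ^ 2 + C a1 * X + C (C a0)) * derivative P =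
      C a2 * (X * (X * derivative P)) + C a1 * (X * derivative P) + C (C a0) * derivative P := by
      ring
    have e2 : (C t * X + C s) * P = C t * (X * P) + C s * P := by ring
    simp only [e1, e2, coeff_add, coeff_C_mul] at h'
    rcases k with _ | _ | k
    · simp [coeff_derivative] at h' ⊢
      exact h'
    · simp [coeff_X_mul, coeff_derivative, coeff_coeffwiseDerivative] at h' ⊢
      linear_combination h'
    · simp [coeff_X_mul, coeff_derivative, coeff_coeffwiseDerivative] at h' ⊢
      linear_combination h'
  have hlead : P.coeff n ≠ 0 := by rw [← hn]; simpa
  have hz (k : ℕ) (hk : n < k) : P.coeff k = 0 := coeff_eq_zero_of_natDegree_lt (by omega)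
  have htop := hc (n + 1)
  simp [coeff_X_mul, hz] at htop
  have hder : derivative (P.coeff n) = 0 := by
    have hdvd : P.coeff n ∣ derivative (P.coeff n) := ⟨t - a2 * n, by linear_combination htop⟩
    by_contra hcon
    exact absurd (degree_le_of_dvd hdvd hcon) (not_le.mpr (degree_derivative_lt hlead))
  obtain ⟨b, hb⟩ : ∃ b, P.coeff n = C b := ⟨_, eq_C_of_derivative_eq_zero hder⟩
  have hb0 : b ≠ 0 := by rintro rfl; simp [hb] at hlead
  have ht : t = a2 * n := by
    rw [hder, zero_add, ← mul_assoc] at htop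
    exact (mul_right_cancel₀ hlead htop).symm
  rcases n with _ | n
  · exact ⟨b, by rw [← hb]; exact eq_C_of_natDegree_eq_zero hn⟩
  exfalso
  have hrec : IsDarbouxRecurrence a0 a1 a2 s (n + 1) (fun k => C b⁻¹ * P.coeff k)
      (fun k => C b⁻¹ * (X * P).coeff k) := by
    refine ⟨by simp, fun k => by simp [coeff_X_mul], ?_, by simp [hz], fun k => ?_⟩
    · simp only [hb, ← C_mul, inv_mul_cancel₀ hb0, C_1]
    · have := hc k
      simp only [derivative_C_mul, C_mul, C_add, C_sub, C_1, map_natCast, ht] at this ⊢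
      linear_combination -C b⁻¹ * this
  exact hrec.elim ha0 ha1 ha2 hl

theorem stmt_12 (K : Type*) [Field K] [CharZero K]
    (a0 : K) (ha0 : a0 ≠ 0)
    (a1 a2 : Polynomial K) (ha1 : 1 ≤ a1.degree) (ha2 : 1 ≤ a2.degree)
    (hl : ¬ ∃ l : K, l ≠ 0 ∧ a2 = Polynomial.C l * a1 - Polynomial.C (l ^ 2 * a0))
    (D : Derivation K (MvPolynomial (Fin 2) K) (MvPolynomial (Fin 2) K))
    (hDx : D (MvPolynomial.X 0) = MvPolynomial.X 1)
    (hDy : D (MvPolynomial.X 1) =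
      Polynomial.aeval (MvPolynomial.X 0) a2 * MvPolynomial.X 1 ^ 2 +
        Polynomial.aeval (MvPolynomial.X 0) a1 * MvPolynomial.X 1 +
        MvPolynomial.C a0) :
    ¬ ∃ (F Λ : MvPolynomial (Fin 2) K),
        (∀ k : K, F ≠ MvPolynomial.C k) ∧ D F = Λ * F := by
  rintro ⟨F, Λ, hF, hDF⟩
  have hq : toBivariate K (D (MvPolynomial.X 1)) =
      C a2 * X ^ 2 + C a1 * X + C (C a0) := by
    have haeval (a : K[X]) : toBivariate K (aeval (MvPolynomial.X 0) a) = C a := by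
      rw [← aeval_algHom_apply]
      induction a using Polynomial.induction_on' with
      | add p q hp hq => rw [map_add, map_add, hp, hq]
      | monomial n c =>
        simp [toBivariate, ← C_mul_X_pow_eq_monomial]
    have h0 : toBivariate K (MvPolynomial.X 1) = X := by simp [toBivariate]
    have hC : toBivariate K (MvPolynomial.C a0) = C (C a0) := by
      simp [toBivariate]
    simp only [hDy, map_add, map_mul, map_pow, haeval, h0, hC]
  have hcomm := toBivariate_derivation D _ hDx hq F
  rw [hDF, map_mul] at hcomm
  obtain ⟨k, hk⟩ := eq_C_C_of_darboux ha0 ha1 ha2 hl hcomm.symm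
  exact hF k (toBivariate_eq_C_C hk)
end

section
/- Let K be a field of characteristic zero, n ≥ 1, and for each 1 ≤ i ≤ n let k_i ≥ 1 be an integer and γ_i(x) ∈ K[x]. Let D = ∂x + Σ_{i=1}^n γ_i(x)·y_i^{k_i}·∂_{y_i} be the K-derivation of K[x,y_1,…,y_n]. Then the image D(K[x,y_1,…,y_n]) is a Mathieu-Zhao space of K[x,y_1,…,y_n] if and only if D is locally finite. -/
/-- A `K`-subspace `M` of `R` is a *Mathieu-Zhao space* if whenever `a ∈ R`
satisfies `a ^ m ∈ M` for all sufficiently large `m`, then for every `b ∈ R`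
one has `b * a ^ m ∈ M` for all sufficiently large `m`. -/
def Submodule.IsMathieuZhao {K R : Type*} [CommRing K] [CommRing R] [Algebra K R]
    (M : Submodule K R) : Prop :=
  ∀ a : R, (∃ N : ℕ, ∀ m : ℕ, N ≤ m → a ^ m ∈ M) →
    ∀ b : R, ∃ N : ℕ, ∀ m : ℕ, N ≤ m → b * a ^ m ∈ M

/-- A `K`-derivation `D` of `R` is *locally finite* if for every `a ∈ R` the
`K`-vector space spanned by the elements `D^i a`, `i ≥ 1`, is finite dimensional. -/
def Derivation.IsLocallyFinite {K R : Type*} [Field K] [CommRing R] [Algebra K R]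
    (D : Derivation K R R) : Prop :=
  ∀ a : R, FiniteDimensional K
    (Submodule.span K (Set.range fun i : ℕ => ((D.toLinearMap : Module.End K R) ^ (i + 1)) a))

/-- A vector killed by a power of a derivation with a slice `s` lies in the image, and so do its
multiples by powers of `s`. -/
theorem Derivation.slice_pow_mul_mem_range {K R : Type*} [Field K] [CharZero K] [CommRing R]
    [Algebra K R] (D : Derivation K R R) {s : R} (hs : D s = 1) (e : ℕ) :
    ∀ (w : R), ((D.toLinearMap : Module.End K R) ^ e) w = 0 →
      ∀ j : ℕ, s ^ j * w ∈ LinearMap.range D.toLinearMap := by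
  induction e with
  | zero =>
    intro w hw j
    have hw' : w = 0 := by simpa using hw
    simp [hw']
  | succ e ih =>
    intro w hw j
    have hDw : s ^ (j + 1) * D w ∈ LinearMap.range D.toLinearMap := by
      refine ih (D w) ?_ (j + 1)
      rw [pow_succ] at hw
      exact hw
    have hD : D (s ^ (j + 1) * w) ∈ LinearMap.range D.toLinearMap := ⟨_, rfl⟩
    have hsub := Submodule.sub_mem _ hD hDw
    have heq : D (s ^ (j + 1) * w) - s ^ (j + 1) * D w = ((j : K) + 1) • (s ^ j * w) := by
      rw [D.leibniz, D.leibniz_pow, hs, Algebra.smul_def ((j : K) + 1)]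
      simp only [smul_eq_mul, nsmul_eq_mul, map_add, map_one,
        add_tsub_cancel_right, mul_one]
      push_cast
      ring
    rw [heq] at hsub
    exact (Submodule.smul_mem_iff _ (Nat.cast_add_one_ne_zero j)).1 hsub

open Polynomial in
/-- Every element is annihilated by a nonzero polynomial in a locally finite derivation. -/
theorem Derivation.IsLocallyFinite.exists_aeval_eq_zero {K R : Type*} [Field K] [CommRing R]
    [Algebra K R] {D : Derivation K R R} (hD : D.IsLocallyFinite) (a : R) :
    ∃ p : K[X], p ≠ 0 ∧ aeval (D.toLinearMap : Module.End K R) (p * X) a = 0 := by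
  by_contra! h
  have := hD a
  let φ : K[X] →ₗ[K] R :=
    (LinearMap.applyₗ (D a)).comp (aeval (D.toLinearMap : Module.End K R)).toLinearMap
  have hφ (p : K[X]) : φ p = aeval (D.toLinearMap : Module.End K R) (p * X) a := by
    simp [φ]
  have hmem (p : K[X]) : φ p ∈ Submodule.span K
      (Set.range fun i : ℕ => ((D.toLinearMap : Module.End K R) ^ (i + 1)) a) := by
    rw [hφ, aeval_eq_sum_range]
    simp only [LinearMap.sum_apply, LinearMap.smul_apply]
    refine Submodule.sum_mem _ fun i _ => ?_
    rcases i with _ | i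
    · simp
    · exact Submodule.smul_mem _ _ (Submodule.subset_span ⟨i, rfl⟩)
  have hinj : Function.Injective (φ.codRestrict _ hmem) := by
    rw [← LinearMap.ker_eq_bot, LinearMap.ker_codRestrict, LinearMap.ker_eq_bot']
    intro p hp
    by_contra hp0
    exact h p hp0 (hφ p ▸ hp)
  exact Polynomial.not_finite (Module.Finite.of_injective _ hinj)

open Polynomial in
/-- A locally finite derivation with a slice is surjective. -/
theorem Derivation.IsLocallyFinite.surjective_of_slice {K R : Type*} [Field K] [CharZero K]
    [CommRing R] [Algebra K R] {D : Derivation K R R} (hD : D.IsLocallyFinite) {s : R}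
    (hs : D s = 1) : LinearMap.range D.toLinearMap = ⊤ := by
  rw [eq_top_iff]
  intro a _
  obtain ⟨p, hp, hpa⟩ := hD.exists_aeval_eq_zero a
  obtain ⟨q, hq, hdvd⟩ := Polynomial.exists_eq_pow_rootMultiplicity_mul_and_not_dvd p hp 0
  simp only [map_zero, sub_zero] at hq hdvd
  set e := p.rootMultiplicity 0
  have hcop : IsCoprime (X ^ (e + 1)) q :=
    IsCoprime.pow_left ((irreducible_X.coprime_iff_not_dvd).2 hdvd)
  obtain ⟨u, v, huv⟩ := hcop
  set T : Module.End K R := D.toLinearMap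
  have hsplit : a = T (aeval T (X ^ e * u) a) + aeval T (v * q) a := by
    have h1 : T (aeval T (X ^ e * u) a) = aeval T (X * (X ^ e * u)) a := by
      simp
    rw [h1, ← LinearMap.add_apply, ← map_add]
    have h2 : X * (X ^ e * u) + v * q = 1 := by rw [← huv]; ring
    rw [h2]
    simp
  rw [hsplit]
  refine Submodule.add_mem _ ⟨_, rfl⟩ ?_
  have hw := D.slice_pow_mul_mem_range hs (e + 1) (aeval T (v * q) a) ?_ 0
  · rwa [pow_zero, one_mul] at hw
  · have h3 : (T ^ (e + 1)) (aeval T (v * q) a) = aeval T (v * (p * X)) a := by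
      have h4 : v * (p * X) = X ^ (e + 1) * (v * q) := by rw [hq]; ring
      rw [h4, map_mul (aeval T) (X ^ (e + 1))]
      simp
    change (T ^ (e + 1)) (aeval T (v * q) a) = 0
    rw [h3, map_mul, Module.End.mul_apply, hpa, map_zero]

/-- A derivation sending the variables to polynomials of degree at most one does not increase the
total degree. -/
theorem Derivation.totalDegree_le_of_X {σ K : Type*} [CommRing K]
    (D : Derivation K (MvPolynomial σ K) (MvPolynomial σ K))
    (h : ∀ i, (D (MvPolynomial.X i)).totalDegree ≤ 1) (f : MvPolynomial σ K) :
    (D f).totalDegree ≤ f.totalDegree := by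
  have hmon (s : σ →₀ ℕ) (r : K) : (D (MvPolynomial.monomial s r)).totalDegree ≤ s.degree := by
    have hD : D = MvPolynomial.mkDerivation K fun i => D (MvPolynomial.X i) :=
      MvPolynomial.derivation_ext fun i => by simp
    rw [hD, MvPolynomial.mkDerivation_monomial]
    refine (MvPolynomial.totalDegree_smul_le _ _).trans ?_
    refine MvPolynomial.totalDegree_finsetSum_le fun i hi => ?_
    simp only [smul_eq_mul]
    refine (MvPolynomial.totalDegree_mul _ _).trans ?_
    refine (Nat.add_le_add (MvPolynomial.totalDegree_monomial_le _ _) (h i)).trans ?_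
    have hle : Finsupp.single i 1 ≤ s := by
      rw [Finsupp.single_le_iff]
      exact Nat.one_le_iff_ne_zero.2 (Finsupp.mem_support_iff.1 hi)
    have hdeg : (s - Finsupp.single i 1).degree + 1 = s.degree := by
      conv_rhs => rw [← tsub_add_cancel_of_le hle]
      simp
    exact hdeg.le
  conv_lhs => rw [f.as_sum, map_sum]
  exact MvPolynomial.totalDegree_finsetSum_le fun s hs =>
    (hmon s _).trans (MvPolynomial.le_totalDegree hs)

theorem Derivation.isLocallyFinite_of_totalDegree_X_le_one {σ K : Type*} [Finite σ] [Field K]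
    (D : Derivation K (MvPolynomial σ K) (MvPolynomial σ K))
    (h : ∀ i, (D (MvPolynomial.X i)).totalDegree ≤ 1) : D.IsLocallyFinite := by
  intro a
  have hpow (m : ℕ) : (((D.toLinearMap : Module.End K _) ^ m) a).totalDegree ≤ a.totalDegree := by
    induction m with
    | zero => simp
    | succ m ih =>
      rw [pow_succ']
      exact (D.totalDegree_le_of_X h _).trans ih
  have hle : Submodule.span K
      (Set.range fun i : ℕ => ((D.toLinearMap : Module.End K _) ^ (i + 1)) a) ≤
      MvPolynomial.restrictTotalDegree σ K a.totalDegree := by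
    rw [Submodule.span_le]
    rintro _ ⟨i, rfl⟩
    exact (MvPolynomial.mem_restrictTotalDegree _ _ _).2 (hpow _)
  have : FiniteDimensional K (MvPolynomial.restrictTotalDegree σ K a.totalDegree) := by
    infer_instance
  exact Submodule.finiteDimensional_of_le hle

open Polynomial in
/-- If `y` lies in the image of `∂x + γ(x) y ^ k ∂y` on `K[x][y]` then `γ = 0`, or `k = 1` and
`γ` is constant. -/
theorem Polynomial.eq_zero_or_const_of_X_eq {K : Type*} [Field K] [CharZero K] {k : ℕ}
    (hk : 1 ≤ k) (γ : K[X]) (g : K[X][X])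
    (hg : ∀ j, derivative (g.coeff j) + γ * (X ^ k * derivative g).coeff j =
      (X : K[X][X]).coeff j) :
    γ = 0 ∨ (k = 1 ∧ γ.natDegree = 0) := by
  obtain rfl | hk2 := hk.eq_or_lt
  · refine Or.inr ⟨rfl, ?_⟩
    have h1 := hg 1
    simp only [coeff_X_pow_mul', coeff_derivative, coeff_X_one] at h1
    norm_num at h1
    by_contra hdeg
    have hg1 : g.coeff 1 ≠ 0 := by
      intro h0
      simp [h0] at h1
    have hγ : γ ≠ 0 := by
      rintro rfl
      simp at hdeg
    have hlt : (derivative (g.coeff 1)).degree < (γ * g.coeff 1).degree := by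
      refine (degree_derivative_lt hg1).trans_le ?_
      rw [mul_comm]
      exact degree_le_mul_left _ hγ
    have hsum := degree_add_eq_right_of_degree_lt hlt
    rw [h1, degree_one, degree_mul, degree_eq_natDegree hγ, degree_eq_natDegree hg1] at hsum
    norm_cast at hsum
    omega
  · left
    by_contra hγ
    obtain ⟨l, rfl⟩ : ∃ l, k = l + 2 := ⟨k - 2, by omega⟩
    have hne (s : ℕ) : g.coeff (s * (l + 1) + 1) ≠ 0 := by
      induction s with
      | zero =>
        intro h0
        have h1 := hg 1
        simp only [zero_mul, zero_add] at h0
        simp [coeff_X_pow_mul', h0] at h1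
      | succ s ih =>
        intro h0
        have h1 := hg ((s + 1) * (l + 1) + 1)
        have hj : (s + 1) * (l + 1) + 1 = s * (l + 1) + (l + 2) := by ring
        have hX : (X : K[X][X]).coeff ((s + 1) * (l + 1) + 1) = 0 := by
          rw [coeff_X_of_ne_one]
          rw [hj]
          omega
        rw [h0, hX, hj, coeff_X_pow_mul, coeff_derivative, derivative_zero, zero_add] at h1
        have hcast : ((s * (l + 1) : ℕ) : K[X]) + 1 ≠ 0 := Nat.cast_add_one_ne_zero _
        exact mul_ne_zero hγ (mul_ne_zero ih hcast) h1
    refine hne g.natDegree (coeff_eq_zero_of_natDegree_lt ?_)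
    nlinarith [Nat.zero_le (g.natDegree * l)]

open Polynomial in
/-- Setting all `y_j` with `j ≠ i` to zero carries `∂x + ∑ γ_j(x) y_j ^ k_j ∂y_j` to
`∂x + γ_i(x) y_i ^ k_i ∂y_i`. -/
theorem Derivation.coeff_aeval_single {K : Type*} [Field K] {n : ℕ} {k : Fin n → ℕ}
    (hk : ∀ i, 1 ≤ k i) {γ : Fin n → K[X]}
    {D : Derivation K (MvPolynomial (Fin (n + 1)) K) (MvPolynomial (Fin (n + 1)) K)}
    (hDx : D (MvPolynomial.X 0) = 1)
    (hDy : ∀ i : Fin n, D (MvPolynomial.X i.succ) =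
      aeval (MvPolynomial.X 0) (γ i) * MvPolynomial.X i.succ ^ k i)
    (i : Fin n) (φ : MvPolynomial (Fin (n + 1)) K →ₐ[K] K[X][X])
    (hφ0 : φ (MvPolynomial.X 0) = C X) (hφi : φ (MvPolynomial.X i.succ) = X)
    (hφj : ∀ j, j ≠ i → φ (MvPolynomial.X j.succ) = 0) (f : MvPolynomial (Fin (n + 1)) K) (m : ℕ) :
    (φ (D f)).coeff m =
      derivative ((φ f).coeff m) + γ i * (X ^ k i * derivative (φ f)).coeff m := by
  have hγ : φ (aeval (MvPolynomial.X 0) (γ i)) = C (γ i) := by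
    rw [← aeval_algHom_apply, hφ0]
    have := aeval_algHom_apply (CAlgHom (R := K) (A := K[X])) X (γ i)
    simpa using this
  induction f using MvPolynomial.induction_on generalizing m with
  | C a =>
    have hC : φ (MvPolynomial.C a) = C (C a) := by
      rw [← MvPolynomial.algebraMap_eq, φ.commutes]
      rfl
    rw [hC]
    simp [coeff_C, apply_ite derivative]
  | add p q hp hq =>
    simp only [map_add, coeff_add, mul_add, hp, hq]
    ring
  | mul_X p j hp =>
    simp only [D.leibniz, map_add, map_mul, smul_eq_mul, coeff_add]
    refine Fin.cases ?_ (fun j => ?_) j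
    · simp only [hDx, hφ0, map_one, mul_one, coeff_C_mul, coeff_mul_C, hp, derivative_mul,
        derivative_C, derivative_X, mul_zero, add_zero, ← mul_assoc]
      ring
    · by_cases hj : j = i
      · subst hj
        simp only [hDy, hφi, map_mul, map_pow, hγ, derivative_mul, derivative_X, mul_one, mul_add,
          coeff_add]
        have h1 : φ p * (C (γ j) * X ^ k j) = C (γ j) * (X ^ k j * φ p) := by ring
        rw [h1, coeff_C_mul, mul_comm X, ← mul_assoc (X ^ k j)]
        rcases m with _ | m
        · simp
        · simp only [coeff_mul_X, hp]
          ring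
      · simp [hDy, hφj j hj, (Nat.one_le_iff_ne_zero.1 (hk j))]

theorem stmt_14 (K : Type*) [Field K] [CharZero K]
    (n : ℕ) (hn : 1 ≤ n)
    (k : Fin n → ℕ) (hk : ∀ i, 1 ≤ k i)
    (γ : Fin n → Polynomial K)
    (D : Derivation K (MvPolynomial (Fin (n + 1)) K) (MvPolynomial (Fin (n + 1)) K))
    (hDx : D (MvPolynomial.X 0) = 1)
    (hDy : ∀ i : Fin n, D (MvPolynomial.X i.succ) =
      Polynomial.aeval (MvPolynomial.X 0) (γ i) * MvPolynomial.X i.succ ^ k i) :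
    (LinearMap.range D.toLinearMap).IsMathieuZhao ↔ D.IsLocallyFinite := by
  constructor
  · intro hMZ
    have hsurj (b : MvPolynomial (Fin (n + 1)) K) : b ∈ LinearMap.range D.toLinearMap := by
      obtain ⟨N, hN⟩ := hMZ 1 ⟨0, fun m _ => by rw [one_pow]; exact ⟨_, hDx⟩⟩ b
      simpa using hN N le_rfl
    refine D.isLocallyFinite_of_totalDegree_X_le_one fun i => ?_
    refine Fin.cases (by simp [hDx]) (fun i => ?_) i
    obtain ⟨f, hf⟩ := hsurj (MvPolynomial.X i.succ)
    let φ : MvPolynomial (Fin (n + 1)) K →ₐ[K] Polynomial (Polynomial K) :=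
      MvPolynomial.aeval (Fin.cons (Polynomial.C Polynomial.X) (Pi.single i Polynomial.X))
    have hφi : φ (MvPolynomial.X i.succ) = Polynomial.X := by simp [φ]
    have hφ := Derivation.coeff_aeval_single hk hDx hDy i φ (by simp [φ]) hφi
      (fun j hj => by simp [φ, hj]) f
    replace hf : D f = MvPolynomial.X i.succ := hf
    rw [hf, hφi] at hφ
    rw [hDy]
    rcases Polynomial.eq_zero_or_const_of_X_eq (hk i) (γ i) (φ f) (fun j => (hφ j).symm) with
      h0 | ⟨h1, h2⟩
    · simp [h0]
    · rw [Polynomial.eq_C_of_natDegree_eq_zero h2, h1, Polynomial.aeval_C, pow_one,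
        ← Algebra.smul_def]
      exact (MvPolynomial.totalDegree_smul_le _ _).trans (MvPolynomial.totalDegree_X _).le
  · intro hD a _ b
    rw [hD.surjective_of_slice hDx]
    exact ⟨0, fun _ _ => trivial⟩
end

section
/- Let K be a field of characteristic zero, n ≥ 2, and for each 1 ≤ i ≤ n let k_i ≥ 1 be an integer and γ_i ∈ K* a nonzero constant, with k_1 > 1. Let D = Σ_{i=1}^n γ_i·y_i^{k_i}·∂_{y_i} be the K-derivation of K[y_1,…,y_n]. Then for every integer m ≥ 0, the polynomial y_1·y_2^m does not belong to the image D(K[y_1,…,y_n]). -/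
namespace MvPolynomial

open Finsupp

/-- A derivation is the combination of partial derivatives with its values at the variables as
coefficients. -/
theorem derivation_apply_eq_sum_mul_pderiv {R σ : Type*} [CommRing R] [Fintype σ]
    (D : Derivation R (MvPolynomial σ R) (MvPolynomial σ R)) (f : MvPolynomial σ R) :
    D f = ∑ i, D (X i) * pderiv i f := by
  classical
  have h : D = ∑ i, D (X i) • (pderiv i : Derivation R (MvPolynomial σ R) (MvPolynomial σ R)) := by
    refine derivation_ext fun j => ?_
    rw [← Derivation.coeFnAddMonoidHom_apply (∑ i, _), map_sum, Finset.sum_apply]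
    simp [pderiv_X, Pi.single_apply]
  conv_lhs => rw [h]
  rw [← Derivation.coeFnAddMonoidHom_apply (∑ i, _), map_sum, Finset.sum_apply]
  simp

theorem coeff_C_mul_X_pow_mul_pderiv {R σ : Type*} [CommRing R] (i : σ) (c : R) (k : ℕ)
    (f : MvPolynomial σ R) (d : σ →₀ ℕ) :
    coeff d (C c * X i ^ k * pderiv i f) =
      if k ≤ d i then
        c * (coeff (d - single i k + single i 1) f * ((d i - k : ℕ) + 1)) else 0 := by
  classical
  rw [C_mul_X_pow_eq_monomial, mul_comm, coeff_mul_monomial']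
  simp only [single_le_iff]
  split_ifs
  · rw [coeff_pderiv, mul_comm c]
    simp
  · rfl

theorem coeff_derivation_single_add_single {R σ : Type*} [CommRing R] [Fintype σ]
    {k : σ → ℕ} (hk : ∀ i, 1 ≤ k i) {γ : σ → R}
    {D : Derivation R (MvPolynomial σ R) (MvPolynomial σ R)}
    (hD : ∀ i, D (X i) = C (γ i) * X i ^ k i) {u v : σ} (huv : u ≠ v)
    (f : MvPolynomial σ R) (p q : ℕ) :
    coeff (single u p + single v q) (D f) =
      (if k u ≤ p then
        γ u * (coeff (single u (p - k u + 1) + single v q) f * ((p - k u : ℕ) + 1)) else 0) +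
      (if k v ≤ q then
        γ v * (coeff (single u p + single v (q - k v + 1)) f * ((q - k v : ℕ) + 1)) else 0) := by
  classical
  rw [derivation_apply_eq_sum_mul_pderiv, coeff_sum]
  simp only [hD, coeff_C_mul_X_pow_mul_pderiv]
  rw [Fintype.sum_eq_add u v huv]
  · have hu : (single u p + single v q : σ →₀ ℕ) u = p := by simp [huv.symm]
    have hv : (single u p + single v q : σ →₀ ℕ) v = q := by simp [huv]
    have eu : (single u p + single v q - single u (k u) + single u 1 : σ →₀ ℕ) =
        single u (p - k u + 1) + single v q := by
      ext j
      by_cases hj : u = j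
      · subst hj; simp [huv.symm]
      · simp [single_apply, hj]
    have ev : (single u p + single v q - single v (k v) + single v 1 : σ →₀ ℕ) =
        single u p + single v (q - k v + 1) := by
      ext j
      by_cases hj : v = j
      · subst hj; simp [huv]
      · simp [single_apply, hj]
    rw [hu, hv, eu, ev]
  · rintro j ⟨hju, hjv⟩
    have := hk j
    rw [if_neg]
    simp [hju.symm, hjv.symm]
    omega

end MvPolynomial

theorem stmt_17 (K : Type*) [Field K] [CharZero K]
    (n : ℕ) (hn : 2 ≤ n)
    (k : Fin n → ℕ) (hk : ∀ i, 1 ≤ k i)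
    (γ : Fin n → K) (hγ : ∀ i, γ i ≠ 0)
    (hk1 : 1 < k ⟨0, by omega⟩)
    (D : Derivation K (MvPolynomial (Fin n) K) (MvPolynomial (Fin n) K))
    (hD : ∀ i : Fin n, D (MvPolynomial.X i) =
      MvPolynomial.C (γ i) * MvPolynomial.X i ^ k i) :
    ∀ m : ℕ, ¬ ∃ f : MvPolynomial (Fin n) K,
      D f = MvPolynomial.X ⟨0, by omega⟩ * MvPolynomial.X ⟨1, by omega⟩ ^ m := by
  rintro m ⟨f, hf⟩
  set u : Fin n := ⟨0, by omega⟩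
  set v : Fin n := ⟨1, by omega⟩
  have huv : u ≠ v := by simp [u, v]
  have hrhs : ∀ p q : ℕ, MvPolynomial.coeff (Finsupp.single u p + Finsupp.single v q) (D f) =
      if p = 1 ∧ q = m then 1 else 0 := by
    intro p q
    rw [hf, MvPolynomial.X, MvPolynomial.X_pow_eq_monomial, MvPolynomial.monomial_mul,
      MvPolynomial.coeff_monomial, one_mul]
    refine if_congr ⟨fun h => ?_, ?_⟩ rfl rfl
    · have h1 := DFunLike.congr_fun h u
      have h2 := DFunLike.congr_fun h v
      simp [huv, huv.symm] at h1 h2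
      exact ⟨h1.symm, h2.symm⟩
    · rintro ⟨rfl, rfl⟩
      rfl
  simp only [MvPolynomial.coeff_derivation_single_add_single hk hD huv] at hrhs
  have key : ∀ s : ℕ, ∃ q,
      MvPolynomial.coeff (Finsupp.single u (1 + s * (k u - 1)) + Finsupp.single v q) f ≠ 0 := by
    intro s
    induction s with
    | zero =>
      refine ⟨m - k v + 1, fun h => ?_⟩
      have := hrhs 1 m
      rw [if_neg (by omega)] at this
      rw [zero_mul, add_zero] at h
      simp only [h, zero_mul, mul_zero, ite_self, add_zero, and_self, if_true] at this
      exact zero_ne_one this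
    | succ s ih =>
      obtain ⟨q, hq⟩ := ih
      refine ⟨q - k v + 1, fun h => ?_⟩
      have := hrhs (1 + (s + 1) * (k u - 1)) q
      have e : 1 + (s + 1) * (k u - 1) = s * (k u - 1) + k u := by
        rw [add_mul]; omega
      have e_ne : ¬(s * (k u - 1) + k u = 1 ∧ q = m) := by omega
      rw [h, e, if_pos (Nat.le_add_left _ _), Nat.add_sub_cancel, if_neg e_ne,
        add_comm (s * (k u - 1)) 1] at this
      have hs : ((s * (k u - 1) : ℕ) : K) + 1 ≠ 0 := Nat.cast_add_one_ne_zero _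
      simp only [zero_mul, mul_zero, ite_self, add_zero] at this
      exact mul_ne_zero (hγ u) (mul_ne_zero hq hs) this
  choose q hq using key
  refine Set.infinite_of_injective_forall_mem (s := (f.support : Set (Fin n →₀ ℕ)))
    (f := fun s => Finsupp.single u (1 + s * (k u - 1)) + Finsupp.single v (q s)) ?_ ?_
    f.support.finite_toSet
  · intro s t hst
    have h1 := DFunLike.congr_fun hst u
    simp only [Finsupp.add_apply, Finsupp.single_eq_same, Finsupp.single_eq_of_ne huv,
      add_zero, add_right_inj] at h1
    exact Nat.eq_of_mul_eq_mul_right (by omega) h1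
  · intro s
    simpa using hq s
end
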